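/- For any multi-GGS-group G, the commutator subgroup of the first-level stabilizer is contained in the third term of the lower central series: st_G(1)′ ≤ γ₃(G). -/

import Mathlib

/-!
Automorphisms of the `p`-regular rooted tree, encoded by portraits:
an automorphism is a family of permutations of `Fin p`, one for each vertex
(vertices are finite words over `Fin p`, the root being `[]`).
-/

namespace TreeAut

variable {p : ℕ}

/-- Automorphisms of the `p`-regular rooted tree, given by their portraits. -/
def AutT (p : ℕ) : Type := List (Fin p) → Equiv.Perm (Fin p)

namespace AutT

/-- The action of a tree automorphism on the vertices (finite words over `Fin p`). -/
def act : AutT p → List (Fin p) → List (Fin p)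
  | _, [] => []
  | f, x :: w => f [] x :: act (fun v => f (x :: v)) w

/-- The section of `f` at the level-one vertex `x`; the map
`f ↦ (sections f 0, …, sections f (p-1))` restricted to the first-level
stabilizer is the isomorphism `ψ`. -/
def sections (f : AutT p) : Fin p → AutT p := fun x v => f (x :: v)

instance : One (AutT p) := ⟨fun _ => 1⟩

instance : Mul (AutT p) := ⟨fun f g v => f (act g v) * g v⟩

/-- The action of the inverse automorphism on vertices. -/
def invAct : AutT p → List (Fin p) → List (Fin p)
  | _, [] => []
  | f, x :: w => (f [])⁻¹ x :: invAct (fun v => f (((f [])⁻¹ x) :: v)) w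

instance : Inv (AutT p) := ⟨fun f v => (f (invAct f v))⁻¹⟩

lemma one_apply (v : List (Fin p)) : (1 : AutT p) v = 1 := rfl

lemma mul_apply (f g : AutT p) (v : List (Fin p)) : (f * g) v = f (act g v) * g v := rfl

lemma inv_apply (f : AutT p) (v : List (Fin p)) : f⁻¹ v = (f (invAct f v))⁻¹ := rfl

lemma act_nil (f : AutT p) : act f [] = [] := rfl

lemma act_cons (f : AutT p) (x : Fin p) (w : List (Fin p)) :
    act f (x :: w) = f [] x :: act (sections f x) w := rfl

lemma sections_mul (f g : AutT p) (x : Fin p) :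
    sections (f * g) x = sections f (g [] x) * sections g x :=
  funext fun _ => rfl

lemma act_one : ∀ v : List (Fin p), act (1 : AutT p) v = v
  | [] => rfl
  | x :: w => congrArg (x :: ·) (act_one w)

lemma act_mul (f g : AutT p) : ∀ v : List (Fin p), act (f * g) v = act f (act g v)
  | [] => rfl
  | x :: w => by
      rw [act_cons (f * g), sections_mul, act_mul, act_cons g, act_cons f]
      rfl

lemma invAct_act (f : AutT p) : ∀ v : List (Fin p), invAct f (act f v) = v
  | [] => rfl
  | x :: w => by
      rw [act_cons]
      show (f [])⁻¹ (f [] x) ::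
          invAct (fun v => f (((f [])⁻¹ (f [] x)) :: v)) (act (sections f x) w) = x :: w
      have h : (f [])⁻¹ (f [] x) = x := Equiv.symm_apply_apply (f []) x
      rw [h]
      exact congrArg (x :: ·) (invAct_act (sections f x) w)

instance : Group (AutT p) where
  mul_assoc f g h := by
    funext v
    show (f * g) (act h v) * h v = f (act (g * h) v) * (g * h) v
    rw [mul_apply, mul_apply, act_mul, mul_assoc]
  one_mul f := by
    funext v
    show (1 : AutT p) (act f v) * f v = f v
    rw [one_apply, one_mul]
  mul_one f := by
    funext v
    show f (act (1 : AutT p) v) * (1 : AutT p) v = f v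
    rw [act_one, one_apply, mul_one]
  inv_mul_cancel f := by
    funext v
    show f⁻¹ (act f v) * f v = (1 : AutT p) v
    rw [inv_apply, invAct_act, one_apply, inv_mul_cancel]

lemma act_length (f : AutT p) : ∀ v : List (Fin p), (act f v).length = v.length
  | [] => rfl
  | _ :: w => congrArg Nat.succ (act_length _ w)

lemma act_act_inv (f : AutT p) (v : List (Fin p)) : act f (act f⁻¹ v) = v := by
  rw [← act_mul, mul_inv_cancel, act_one]

/-- The pointwise stabilizer `st(n)` of the `n`-th level of the tree. -/
def levelStab (p n : ℕ) : Subgroup (AutT p) where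
  carrier := {f | ∀ v : List (Fin p), v.length = n → act f v = v}
  one_mem' := fun v _ => act_one v
  mul_mem' := by
    intro f g hf hg v hv
    rw [act_mul, hg v hv, hf v hv]
  inv_mem' := by
    intro f hf v hv
    have h1 : act f (act f⁻¹ v) = v := act_act_inv f v
    have h2 : act f (act f⁻¹ v) = act f⁻¹ v := hf _ (by rw [act_length, hv])
    exact h2.symm.trans h1

instance levelStab_normal (p n : ℕ) : (levelStab p n).Normal := by
  constructor
  intro f hf g v hv
  show act (g * f * g⁻¹) v = v
  rw [act_mul, act_mul, hf _ (by rw [act_length, hv]), act_act_inv]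

/-- The tuple of sections at the level-two vertices.  Restricted to the
second-level stabilizer this is the map `ψ₂`. -/
def sections2 (f : AutT p) : Fin p → Fin p → AutT p := fun x y v => f (x :: y :: v)

/-- The rooted automorphism defined by a permutation `σ` of `Fin p`. -/
def rooted (σ : Equiv.Perm (Fin p)) : AutT p := fun v => if v = [] then σ else 1

/-- The rooted automorphism `a`, acting at the root by the cycle `(1 2 … p)`. -/
def rootedA (p : ℕ) : AutT p := rooted (finRotate p)

/-- Auxiliary portrait for the directed automorphism `b_e`. -/
def directedAux (e : Fin (p - 1) → ZMod p) : List (Fin p) → Equiv.Perm (Fin p)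
  | [] => 1
  | x :: w =>
      if h : (x : ℕ) < p - 1 then
        (if w = [] then finRotate p ^ ((e ⟨x, h⟩).val) else 1)
      else directedAux e w

/-- The directed automorphism `b_e` defined by the vector `e ∈ 𝔽_p^{p-1}`,
i.e. the unique automorphism with `ψ(b_e) = (a^{e_1}, …, a^{e_{p-1}}, b_e)`. -/
def directed (e : Fin (p - 1) → ZMod p) : AutT p := directedAux e

/-- The multi-GGS-group determined by the vectors `e 1, …, e r`. -/
def multiGGS (p : ℕ) {r : ℕ} (e : Fin r → Fin (p - 1) → ZMod p) : Subgroup (AutT p) :=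
  Subgroup.closure ({rootedA p} ∪ Set.range fun i => directed (e i))

/-- The GGS-group `𝒢` defined by the (nonzero) constant vector `(c, …, c)`. -/
def constGGS (p : ℕ) (c : ZMod p) : Subgroup (AutT p) :=
  Subgroup.closure {rootedA p, directed (fun _ => c)}

/-- `G` is the GGS-group `𝒢` defined by a constant vector. -/
def IsConstGGS {p : ℕ} (G : Subgroup (AutT p)) : Prop :=
  ∃ c : ZMod p, c ≠ 0 ∧ G = constGGS p c

/-- The stabilizer `st_G(n) = G ∩ st(n)`, viewed as a subgroup of `G`. -/
def stabIn {p : ℕ} (G : Subgroup (AutT p)) (n : ℕ) : Subgroup G :=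
  (levelStab p n).comap G.subtype

instance {p : ℕ} (G : Subgroup (AutT p)) (n : ℕ) : (stabIn G n).Normal :=
  Subgroup.Normal.comap (levelStab_normal p n) G.subtype

/-- The congruence subgroup property: every finite-index subgroup of `G`
contains a level stabilizer `st_G(n)`. -/
def HasCSP {p : ℕ} (G : Subgroup (AutT p)) : Prop :=
  ∀ H : Subgroup G, H.FiniteIndex → ∃ n : ℕ, stabIn G n ≤ H

/-- `G` is just infinite: it is infinite and all its nontrivial normal
subgroups have finite index. -/
def JustInfinite {p : ℕ} (G : Subgroup (AutT p)) : Prop :=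
  Infinite G ∧ ∀ N : Subgroup G, N.Normal → N ≠ ⊥ → N.FiniteIndex

end AutT

end TreeAut

namespace TreeAut

section Group

open scoped commutatorElement

variable {Γ : Type*} [Group Γ]

/-- An element of `⟨a, S⟩` factors as a power of `a`, an element of `⟨S⟩`, and an element of
the derived subgroup. -/
lemma exists_eq_zpow_mul_mul_of_mem_closure {a : Γ} {S : Set Γ} {g : Γ}
    (hg : g ∈ Subgroup.closure ({a} ∪ S)) :
    ∃ k : ℤ, ∃ b ∈ Subgroup.closure S,
      ∃ c ∈ ⁅Subgroup.closure ({a} ∪ S), Subgroup.closure ({a} ∪ S)⁆, g = a ^ k * b * c := by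
  have ha : a ∈ Subgroup.closure ({a} ∪ S) := Subgroup.subset_closure (Or.inl rfl)
  have hle : Subgroup.closure S ≤ Subgroup.closure ({a} ∪ S) :=
    Subgroup.closure_mono Set.subset_union_right
  have push : ∀ s ∈ Subgroup.closure S, ∀ (k : ℤ), ∀ b ∈ Subgroup.closure S,
      ∀ c ∈ ⁅Subgroup.closure ({a} ∪ S), Subgroup.closure ({a} ∪ S)⁆,
      ∃ k' : ℤ, ∃ b' ∈ Subgroup.closure S,
        ∃ c' ∈ ⁅Subgroup.closure ({a} ∪ S), Subgroup.closure ({a} ∪ S)⁆,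
          s * (a ^ k * b * c) = a ^ k' * b' * c' := by
    intro s hs k b hb c hc
    refine ⟨k, s * b, mul_mem hs hb, ⁅b⁻¹ * s⁻¹ * b, b⁻¹ * (a ^ k)⁻¹ * b⁆ * c,
      mul_mem (Subgroup.commutator_mem_commutator ?_ ?_) hc, ?_⟩
    · exact mul_mem (mul_mem (inv_mem (hle hb)) (inv_mem (hle hs))) (hle hb)
    · exact mul_mem (mul_mem (inv_mem (hle hb)) (inv_mem (zpow_mem ha k))) (hle hb)
    · rw [commutatorElement_def]
      group
  induction hg using Subgroup.closure_induction_left with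
  | one => exact ⟨0, 1, one_mem _, 1, one_mem _, by simp⟩
  | mul_left x hx y _ ih =>
    obtain ⟨k, b, hb, c, hc, rfl⟩ := ih
    rcases hx with rfl | hx
    · exact ⟨1 + k, b, hb, c, hc, by rw [zpow_add, zpow_one]; simp only [mul_assoc]⟩
    · exact push x (Subgroup.subset_closure hx) k b hb c hc
  | inv_mul_cancel x hx y _ ih =>
    obtain ⟨k, b, hb, c, hc, rfl⟩ := ih
    rcases hx with rfl | hx
    · exact ⟨-1 + k, b, hb, c, hc, by rw [zpow_add, zpow_neg_one]; simp only [mul_assoc]⟩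
    · exact push x⁻¹ (inv_mem (Subgroup.subset_closure hx)) k b hb c hc

/-- If two elements of `G` are congruent modulo the derived subgroup to commuting elements of
`G`, their commutator lies in the third term of the lower central series. -/
lemma commutator_mul_mul_mem_of_commute {G : Subgroup Γ} {b b' c c' : Γ}
    (hb : b ∈ G) (hb' : b' ∈ G) (hc : c ∈ ⁅G, G⁆) (hc' : c' ∈ ⁅G, G⁆) (h : Commute b b') :
    ⁅b * c, b' * c'⁆ ∈ ⁅⁅G, G⁆, G⁆ := by
  have hle : ⁅G, G⁆ ≤ G := Subgroup.commutator_le_self G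
  have conj_mem : ∀ x ∈ G, ∀ y ∈ ⁅G, G⁆, x * y * x⁻¹ ∈ ⁅G, G⁆ := by
    intro x hx y hy
    have := mul_mem (Subgroup.commutator_mem_commutator hx (hle hy)) hy
    rwa [commutatorElement_def, inv_mul_cancel_right] at this
  have key : ⁅b * c, b' * c'⁆ = ⁅b * c * b⁻¹, b * (b' * c') * b⁻¹⁆ * ⁅b, b'⁆ *
      ⁅b' * c' * b'⁻¹, b' * b * b'⁻¹⁆⁻¹ := by
    simp only [commutatorElement_def]
    group
  rw [key, commutatorElement_eq_one_iff_commute.mpr h, mul_one]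
  refine mul_mem (Subgroup.commutator_mem_commutator (conj_mem b hb c hc) ?_)
    (inv_mem (Subgroup.commutator_mem_commutator (conj_mem b' hb' c' hc') ?_))
  · exact mul_mem (mul_mem hb (mul_mem hb' (hle hc'))) (inv_mem hb)
  · exact mul_mem (mul_mem hb' hb) (inv_mem hb')

end Group

namespace AutT

variable {p : ℕ}

/-- The action at the root, as a homomorphism. -/
def rootHom (p : ℕ) : AutT p →* Equiv.Perm (Fin p) where
  toFun f := f []
  map_one' := rfl
  map_mul' _ _ := rfl

lemma mem_levelStab_one_iff {f : AutT p} : f ∈ levelStab p 1 ↔ rootHom p f = 1 := by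
  constructor
  · intro h
    ext x : 1
    have := h [x] rfl
    rw [act_cons] at this
    exact (List.cons.inj this).1
  · intro h v hv
    obtain ⟨x, rfl⟩ := List.length_eq_one_iff.mp hv
    have hx : f [] x = x := DFunLike.congr_fun h x
    rw [act_cons, hx]
    rfl

/-- The embedding of permutations as rooted automorphisms, as a homomorphism. -/
def rootedHom (p : ℕ) : Equiv.Perm (Fin p) →* AutT p where
  toFun := rooted
  map_one' := by
    funext v
    simp [rooted, one_apply]
  map_mul' σ τ := by
    funext v
    cases v with
    | nil => rfl
    | cons x w => simp [rooted, mul_apply, act_cons]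

lemma rootHom_rootedHom (σ : Equiv.Perm (Fin p)) : rootHom p (rootedHom p σ) = σ := rfl

lemma rootHom_directed (e : Fin (p - 1) → ZMod p) : rootHom p (directed e) = 1 := rfl

lemma sections_directed_of_lt (e : Fin (p - 1) → ZMod p) {x : Fin p} (h : (x : ℕ) < p - 1) :
    sections (directed e) x = rootedHom p (finRotate p ^ (e ⟨x, h⟩).val) := by
  funext w
  change directedAux e (x :: w) = if w = [] then finRotate p ^ (e ⟨x, h⟩).val else 1
  rw [directedAux, dif_pos h]

lemma sections_directed_of_not_lt (e : Fin (p - 1) → ZMod p) {x : Fin p}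
    (h : ¬ (x : ℕ) < p - 1) : sections (directed e) x = directed e := by
  funext w
  simp [sections, directed, directedAux, h]

lemma directed_commute (e f : Fin (p - 1) → ZMod p) : Commute (directed e) (directed f) := by
  funext v
  induction v with
  | nil => rfl
  | cons x w ih =>
    have hroot : ∀ e : Fin (p - 1) → ZMod p, directed e [] = 1 := fun _ => rfl
    change sections (directed e * directed f) x w = sections (directed f * directed e) x w
    rw [sections_mul, sections_mul, hroot, hroot, Equiv.Perm.one_apply]
    by_cases h : (x : ℕ) < p - 1
    · simp only [sections_directed_of_lt _ h, ← map_mul]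
      rw [← pow_add, ← pow_add, add_comm]
    · simpa only [sections_directed_of_not_lt _ h] using ih

lemma closure_range_directed_le_levelStab {r : ℕ} (e : Fin r → Fin (p - 1) → ZMod p) :
    Subgroup.closure (Set.range fun i => directed (e i)) ≤ levelStab p 1 := by
  rw [Subgroup.closure_le]
  rintro _ ⟨i, rfl⟩
  exact mem_levelStab_one_iff.mpr (rootHom_directed (e i))

lemma commute_of_mem_closure_range_directed {r : ℕ} (e : Fin r → Fin (p - 1) → ZMod p)
    {b b' : AutT p} (hb : b ∈ Subgroup.closure (Set.range fun i => directed (e i)))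
    (hb' : b' ∈ Subgroup.closure (Set.range fun i => directed (e i))) : Commute b b' := by
  induction hb, hb' using Subgroup.closure_induction₂ with
  | mem x y hx hy =>
    obtain ⟨i, rfl⟩ := hx
    obtain ⟨j, rfl⟩ := hy
    exact directed_commute (e i) (e j)
  | one_left => exact Commute.one_left _
  | one_right => exact Commute.one_right _
  | mul_left _ _ _ _ _ _ h₁ h₂ => exact h₁.mul_left h₂
  | mul_right _ _ _ _ _ _ h₁ h₂ => exact h₁.mul_right h₂
  | inv_left _ _ _ _ h => exact h.inv_left
  | inv_right _ _ _ _ h => exact h.inv_right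

lemma multiGGS_le_comap_zpowers {r : ℕ} (e : Fin r → Fin (p - 1) → ZMod p) :
    multiGGS p e ≤ (Subgroup.zpowers (finRotate p)).comap (rootHom p) := by
  rw [multiGGS, Subgroup.closure_le]
  rintro _ (rfl | ⟨i, rfl⟩)
  · exact Subgroup.mem_zpowers (finRotate p)
  · exact one_mem (Subgroup.zpowers (finRotate p))

lemma commutator_multiGGS_le_levelStab {r : ℕ} (e : Fin r → Fin (p - 1) → ZMod p) :
    ⁅multiGGS p e, multiGGS p e⁆ ≤ levelStab p 1 := by
  rw [Subgroup.commutator_le]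
  intro g hg h hh
  obtain ⟨m, hm⟩ := multiGGS_le_comap_zpowers e hg
  obtain ⟨n, hn⟩ := multiGGS_le_comap_zpowers e hh
  rw [mem_levelStab_one_iff, map_commutatorElement, commutatorElement_eq_one_iff_commute,
    ← hm, ← hn]
  exact (Commute.refl (finRotate p)).zpow_zpow m n

/-- The first-level stabilizer of a multi-GGS-group is generated modulo the derived subgroup
by the directed generators. -/
lemma exists_eq_mul_of_mem_levelStab {r : ℕ} (e : Fin r → Fin (p - 1) → ZMod p) {g : AutT p}
    (hg : g ∈ levelStab p 1 ⊓ multiGGS p e) :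
    ∃ b ∈ Subgroup.closure (Set.range fun i => directed (e i)),
      ∃ c ∈ ⁅multiGGS p e, multiGGS p e⁆, g = b * c := by
  obtain ⟨k, b, hb, c, hc, rfl⟩ := exists_eq_zpow_mul_mul_of_mem_closure hg.2
  refine ⟨b, hb, c, hc, ?_⟩
  have hroot := mem_levelStab_one_iff.mp hg.1
  have ha : rootedA p ^ k = rootedHom p (finRotate p ^ k) := (map_zpow (rootedHom p) _ k).symm
  rw [map_mul, map_mul, mem_levelStab_one_iff.mp (closure_range_directed_le_levelStab e hb),
    mem_levelStab_one_iff.mp (commutator_multiGGS_le_levelStab e hc), mul_one, mul_one, ha,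
    rootHom_rootedHom] at hroot
  rw [ha, hroot, map_one, one_mul]

end AutT

end TreeAut

open TreeAut AutT Subgroup

/-- For any multi-GGS-group `G`, one has `st_G(1)' ≤ γ₃(G)`. -/
theorem derived_stab_le_gamma3
    (p r : ℕ) (hp : p.Prime) (hpodd : Odd p) (hr : 1 ≤ r)
    (e : Fin r → Fin (p - 1) → ZMod p) (he : LinearIndependent (ZMod p) e) :
    (⁅levelStab p 1 ⊓ multiGGS p e, levelStab p 1 ⊓ multiGGS p e⁆ : Subgroup (AutT p)) ≤ ⁅⁅multiGGS p e, multiGGS p e⁆, multiGGS p e⁆ := by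
  rw [Subgroup.commutator_le]
  intro g hg h hh
  obtain ⟨b, hb, c, hc, rfl⟩ := exists_eq_mul_of_mem_levelStab e hg
  obtain ⟨b', hb', c', hc', rfl⟩ := exists_eq_mul_of_mem_levelStab e hh
  have hle : closure (Set.range fun i => directed (e i)) ≤ multiGGS p e :=
    closure_mono Set.subset_union_right
  exact commutator_mul_mul_mem_of_commute (hle hb) (hle hb') hc hc'
    (commute_of_mem_closure_range_directed e hb hb')
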